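/- Let ρ be an n×n density matrix with diagonal-entry vector d, and let X be a set of probability vectors that contains the outcome distribution of some von Neumann measurement on ρ. Then λ(ρ) ≻ d ∨ (⋀_{p∈X} p), and consequently C_r(ρ) ≥ S(d) − S(d ∨ (⋀_{p∈X} p)), where ⋀_{p∈X} p is the majorization meet of all vectors in X. -/

import Mathlib

open Matrix Finset ComplexOrder

/-- The vector `x` sorted in descending order. -/
noncomputable def sortDesc {n : ℕ} (x : Fin n → ℝ) : Fin n → ℝ :=
  fun i => x (Tuple.sort x i.rev)

/-- The sum of the `k` largest entries of `x`. -/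
noncomputable def topSum {n : ℕ} (x : Fin n → ℝ) (k : ℕ) : ℝ :=
  ∑ i ∈ Finset.univ.filter (fun i : Fin n => (i : ℕ) < k), sortDesc x i

/-- `Maj b a` means `b ≺ a`, i.e. `a` majorizes `b`. -/
def Maj {n : ℕ} (b a : Fin n → ℝ) : Prop := ∀ k : ℕ, topSum b k ≤ topSum a k

/-- `p` is a probability vector. -/
def IsProbVec {n : ℕ} (p : Fin n → ℝ) : Prop := (∀ i, 0 ≤ p i) ∧ ∑ i, p i = 1

/-- Shannon entropy (base 2). -/
noncomputable def shannon {ι : Type*} [Fintype ι] (p : ι → ℝ) : ℝ :=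
  -∑ i, p i * Real.logb 2 (p i)

/-- A von Neumann measurement: an orthonormal basis of `ℂⁿ`. -/
def IsONB {n : ℕ} (ψ : Fin n → (Fin n → ℂ)) : Prop :=
  ∀ i j, star (ψ i) ⬝ᵥ ψ j = if i = j then 1 else 0

/-- Outcome distribution of the measurement `ψ` on the state `ρ`. -/
noncomputable def outcome {n : ℕ} (ρ : Matrix (Fin n) (Fin n) ℂ)
    (ψ : Fin n → (Fin n → ℂ)) : Fin n → ℝ :=
  fun i => (star (ψ i) ⬝ᵥ (ρ *ᵥ ψ i)).re

/-- Vector of diagonal entries of `ρ` (real parts). -/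
noncomputable def diagVec {n : ℕ} (ρ : Matrix (Fin n) (Fin n) ℂ) : Fin n → ℝ :=
  fun i => (ρ i i).re

/-- `c` is the majorization join of `a` and `b`. -/
def IsMajJoin {n : ℕ} (a b c : Fin n → ℝ) : Prop :=
  IsProbVec c ∧ Maj a c ∧ Maj b c ∧
    ∀ c', IsProbVec c' → Maj a c' → Maj b c' → Maj c c'

/-- `c` is the majorization meet of the set `X`. -/
def IsMajMeet {n : ℕ} (X : Set (Fin n → ℝ)) (c : Fin n → ℝ) : Prop :=
  IsProbVec c ∧ (∀ p ∈ X, Maj c p) ∧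
    ∀ c', IsProbVec c' → (∀ p ∈ X, Maj c' p) → Maj c' c

/-- The permutation arranging `x` in descending order. -/
noncomputable def descPerm {n : ℕ} (x : Fin n → ℝ) : Equiv.Perm (Fin n) :=
  Fin.revPerm.trans (Tuple.sort x)

lemma sortDesc_eq_comp {n : ℕ} (x : Fin n → ℝ) : sortDesc x = x ∘ descPerm x := rfl

lemma antitone_sortDesc {n : ℕ} (x : Fin n → ℝ) : Antitone (sortDesc x) := fun _ _ h =>
  Tuple.monotone_sort x (Fin.rev_le_rev.mpr h)

lemma sum_comp_sortDesc {n : ℕ} (f : ℝ → ℝ) (x : Fin n → ℝ) :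
    ∑ i, f (sortDesc x i) = ∑ i, f (x i) :=
  Equiv.sum_comp (descPerm x) fun i => f (x i)

lemma topSum_eq_sum {n : ℕ} (x : Fin n → ℝ) : topSum x n = ∑ i, x i := by
  simpa [topSum] using sum_comp_sortDesc id x

/-- Weights in `[0, 1]` of total mass at most that of the first `k` positions give a weighted
sum of nonnegative entries bounded by `topSum`. -/
lemma sum_mul_le_topSum {n : ℕ} {x : Fin n → ℝ} (hx : ∀ i, 0 ≤ x i) {w : Fin n → ℝ}
    (hw₀ : ∀ i, 0 ≤ w i) (hw₁ : ∀ i, w i ≤ 1) (k : ℕ)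
    (hw : ∑ i, w i = #{i : Fin n | (i : ℕ) < k}) : ∑ i, w i * x i ≤ topSum x k := by
  obtain ⟨t, ht₁, ht₂⟩ : ∃ t, (∀ i : Fin n, (i : ℕ) < k → t ≤ sortDesc x i) ∧
      ∀ i : Fin n, ¬ (i : ℕ) < k → sortDesc x i ≤ t := by
    by_cases hk : k < n
    · exact ⟨sortDesc x ⟨k, hk⟩, fun i hi => antitone_sortDesc x (Fin.le_def.2 hi.le),
        fun i hi => antitone_sortDesc x (Fin.le_def.2 (not_lt.1 hi))⟩
    · exact ⟨0, fun i _ => hx _, fun i hi => absurd (i.2.trans_le (not_lt.1 hk)) hi⟩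
  have hsum : ∑ i, w (descPerm x i) = ∑ i : Fin n, if (i : ℕ) < k then (1 : ℝ) else 0 := by
    rw [Equiv.sum_comp (descPerm x) w, hw]
    simp
  have hwx : ∑ i, w i * x i = ∑ i, w (descPerm x i) * sortDesc x i :=
    (Equiv.sum_comp (descPerm x) fun i => w i * x i).symm
  have hpos : 0 ≤ ∑ i : Fin n,
      ((if (i : ℕ) < k then (1 : ℝ) else 0) - w (descPerm x i)) * (sortDesc x i - t) := by
    refine Finset.sum_nonneg fun i _ => ?_
    split_ifs with hi
    · exact mul_nonneg (sub_nonneg.2 (hw₁ _)) (sub_nonneg.2 (ht₁ i hi))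
    · exact mul_nonneg_of_nonpos_of_nonpos (by linarith [hw₀ (descPerm x i)])
        (sub_nonpos.2 (ht₂ i hi))
  have htop : topSum x k = ∑ i : Fin n, (if (i : ℕ) < k then (1 : ℝ) else 0) * sortDesc x i := by
    simp [topSum, Finset.sum_filter]
  simp only [sub_mul, mul_sub, Finset.sum_sub_distrib, ← Finset.sum_mul] at hpos
  rw [hwx, htop]
  rw [hsum] at hpos
  linarith

lemma maj_mulVec_of_mem_doublyStochastic {n : ℕ} {D : Matrix (Fin n) (Fin n) ℝ}
    (hD : D ∈ doublyStochastic ℝ (Fin n)) {x : Fin n → ℝ} (hx : ∀ i, 0 ≤ x i) :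
    Maj (D *ᵥ x) x := by
  intro k
  set F : Finset (Fin n) := {i | (i : ℕ) < k}
  set e := descPerm (D *ᵥ x)
  have htop : topSum (D *ᵥ x) k = ∑ j, (∑ i ∈ F, D (e i) j) * x j := by
    simp only [Finset.sum_mul]
    rw [Finset.sum_comm]
    rfl
  rw [htop]
  refine sum_mul_le_topSum hx
    (fun j => Finset.sum_nonneg fun i _ => nonneg_of_mem_doublyStochastic hD) (fun j => ?_) k ?_
  · calc ∑ i ∈ F, D (e i) j ≤ ∑ i, D (e i) j :=
          Finset.sum_le_univ_sum_of_nonneg fun i => nonneg_of_mem_doublyStochastic hD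
      _ = 1 := by
          rw [Equiv.sum_comp e fun i => D i j, sum_col_of_mem_doublyStochastic hD]
  · rw [Finset.sum_comm]
    simp [sum_row_of_mem_doublyStochastic hD, F]

lemma normSq_mem_doublyStochastic {n : ℕ} {W : Matrix (Fin n) (Fin n) ℂ}
    (hW : W ∈ Matrix.unitaryGroup (Fin n) ℂ) :
    Matrix.of (fun i j => Complex.normSq (W j i)) ∈ doublyStochastic ℝ (Fin n) := by
  refine mem_doublyStochastic_iff_sum.2 ⟨fun i j => Complex.normSq_nonneg _, fun i => ?_,
    fun j => ?_⟩
  · have h := congrFun₂ (Matrix.mem_unitaryGroup_iff'.1 hW) i i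
    simp only [Matrix.mul_apply, Matrix.star_apply, Matrix.one_apply_eq, Complex.star_def,
      ← Complex.normSq_eq_conj_mul_self] at h
    exact_mod_cast h
  · have h := congrFun₂ (Matrix.mem_unitaryGroup_iff.1 hW) j j
    simp only [Matrix.mul_apply, Matrix.star_apply, Matrix.one_apply_eq, Complex.star_def,
      Complex.mul_conj] at h
    exact_mod_cast h

/-- The outcome distribution of any von Neumann measurement is majorized by the spectrum. -/
lemma maj_outcome_eigenvalues {n : ℕ} {ρ : Matrix (Fin n) (Fin n) ℂ} (hρ : ρ.PosSemidef)
    {ψ : Fin n → (Fin n → ℂ)} (hψ : IsONB ψ) :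
    Maj (outcome ρ ψ) hρ.isHermitian.eigenvalues := by
  set U : Matrix (Fin n) (Fin n) ℂ := ↑hρ.isHermitian.eigenvectorUnitary
  set P : Matrix (Fin n) (Fin n) ℂ := Matrix.of fun a i => ψ i a
  have hPmem : P ∈ Matrix.unitaryGroup (Fin n) ℂ := by
    rw [Matrix.mem_unitaryGroup_iff']
    ext i j
    rw [Matrix.one_apply, ← hψ i j]
    rfl
  have hW : star U * P ∈ Matrix.unitaryGroup (Fin n) ℂ :=
    mul_mem (star hρ.isHermitian.eigenvectorUnitary).2 hPmem
  have hspec : ρ = U * diagonal (RCLike.ofReal ∘ hρ.isHermitian.eigenvalues) * star U := by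
    conv_lhs => rw [hρ.isHermitian.spectral_theorem, Unitary.conjStarAlgAut_apply]
  suffices h : outcome ρ ψ = Matrix.of (fun i j => Complex.normSq ((star U * P) j i)) *ᵥ
      hρ.isHermitian.eigenvalues by
    rw [h]
    exact maj_mulVec_of_mem_doublyStochastic (normSq_mem_doublyStochastic hW)
      hρ.eigenvalues_nonneg
  ext i
  have hout : star (ψ i) ⬝ᵥ (ρ *ᵥ ψ i) = (star P * (ρ * P)) i i := rfl
  have hmat : star P * (ρ * P) = star (star U * P) *
      (diagonal (RCLike.ofReal ∘ hρ.isHermitian.eigenvalues) * (star U * P)) := by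
    conv_lhs => rw [hspec]
    simp only [star_mul, star_star, mul_assoc]
  rw [outcome, hout, hmat, Matrix.mul_apply, Complex.re_sum]
  refine Finset.sum_congr rfl fun j _ => ?_
  rw [Matrix.diagonal_mul, Matrix.star_apply, mul_left_comm, Complex.star_def,
    ← Complex.normSq_eq_conj_mul_self]
  simp [mul_comm]

lemma isONB_single {n : ℕ} : IsONB fun i : Fin n => Pi.single i (1 : ℂ) := by
  intro i j
  simp [Pi.single_apply, eq_comm]

lemma outcome_single {n : ℕ} (ρ : Matrix (Fin n) (Fin n) ℂ) :
    outcome ρ (fun i => Pi.single i 1) = diagVec ρ := by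
  ext i
  simp [outcome, diagVec]

/-- Summation by parts: an antitone sequence pairs nonnegatively with a sequence whose partial
sums are nonnegative, once a lower bound is subtracted. -/
lemma sum_sub_mul_nonneg_of_antitone {n : ℕ} {g v : Fin n → ℝ} {c : ℝ} (hg : Antitone g)
    (hc : ∀ i, c ≤ g i) (hv : ∀ k : ℕ, 0 ≤ ∑ i : Fin n, if (i : ℕ) < k then v i else 0) :
    0 ≤ ∑ i, (g i - c) * v i := by
  induction n generalizing c with
  | zero => simp
  | succ n ih =>
    have h₁ := ih (g := g ∘ Fin.castSucc) (v := v ∘ Fin.castSucc) (c := g (Fin.last n))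
      (hg.comp_monotone Fin.strictMono_castSucc.monotone) (fun i => hg (Fin.le_last _))
      fun k => by
        have := hv (min k n)
        rw [Fin.sum_univ_castSucc] at this
        simpa using this
    have h₂ : 0 ≤ ∑ i, v i := by
      have := hv (n + 1)
      simpa only [Fin.is_lt, if_true] using this
    have h₃ : ∑ i, (g i - c) * v i =
        ∑ i, (g i - g (Fin.last n)) * v i + (g (Fin.last n) - c) * ∑ i, v i := by
      rw [Finset.mul_sum, ← Finset.sum_add_distrib]
      exact Finset.sum_congr rfl fun i _ => by ring
    rw [h₃, Fin.sum_univ_castSucc]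
    have h₄ := mul_nonneg (sub_nonneg.2 (hc (Fin.last n))) h₂
    simp only [Function.comp_apply] at h₁
    simpa using add_nonneg h₁ h₄

lemma sum_mul_le_sum_mul_of_maj {n : ℕ} {a b g : Fin n → ℝ} (hab : Maj b a)
    (hsum : ∑ i, b i = ∑ i, a i) (hg : Antitone g) :
    ∑ i, g i * sortDesc b i ≤ ∑ i, g i * sortDesc a i := by
  obtain ⟨c, hc⟩ : ∃ c, ∀ i, c ≤ g i := by
    obtain ⟨c, hc⟩ := (Set.finite_range g).bddBelow
    exact ⟨c, fun i => hc ⟨i, rfl⟩⟩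
  have h := sum_sub_mul_nonneg_of_antitone (v := sortDesc a - sortDesc b) hg hc fun k => by
    have := hab k
    simp only [topSum, Finset.sum_filter] at this
    rw [← sub_nonneg, ← Finset.sum_sub_distrib] at this
    convert this using 2 with i
    split_ifs <;> simp
  have ha := sum_comp_sortDesc id a
  have hb := sum_comp_sortDesc id b
  simp only [id] at ha hb
  simp only [sub_mul, Pi.sub_apply, mul_sub, Finset.sum_sub_distrib, ← Finset.mul_sum, ha, hb,
    hsum] at h
  linarith

lemma mul_log_add_sub_le {a t : ℝ} (ha : 0 ≤ a) (ht : 0 < t) :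
    a * Real.log t + (a - t) ≤ a * Real.log a := by
  rcases ha.eq_or_lt with rfl | ha
  · simpa using ht.le
  have h := mul_le_mul_of_nonneg_left (Real.log_le_sub_one_of_pos (div_pos ht ha)) ha.le
  rw [Real.log_div ht.ne' ha.ne', mul_sub, mul_sub, mul_div_cancel₀ _ ha.ne'] at h
  linarith

lemma mul_log_le_mul_log_max {b δ : ℝ} (hb : 0 ≤ b) :
    b * Real.log b ≤ b * Real.log (max b δ) := by
  rcases hb.eq_or_lt with rfl | hb
  · simp
  · exact mul_le_mul_of_nonneg_left (Real.log_le_log hb (le_max_left _ _)) hb.le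

lemma sum_mul_log_le_of_maj {n : ℕ} {a b : Fin n → ℝ} (ha : ∀ i, 0 ≤ a i) (hb : ∀ i, 0 ≤ b i)
    (hsum : ∑ i, b i = ∑ i, a i) (hab : Maj b a) :
    ∑ i, b i * Real.log (b i) ≤ ∑ i, a i * Real.log (a i) := by
  rw [← sum_comp_sortDesc (fun x => x * Real.log x) a,
    ← sum_comp_sortDesc (fun x => x * Real.log x) b]
  have ha' : ∀ i, 0 ≤ sortDesc a i := fun i => ha _
  have hb' : ∀ i, 0 ≤ sortDesc b i := fun i => hb _
  have hsum' : ∑ i, sortDesc b i = ∑ i, sortDesc a i :=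
    (sum_comp_sortDesc id b).trans (hsum.trans (sum_comp_sortDesc id a).symm)
  have key : ∀ δ : ℝ, 0 < δ → ∑ i, sortDesc b i * Real.log (sortDesc b i) ≤
      ∑ i, sortDesc a i * Real.log (sortDesc a i) + n * δ := by
    intro δ hδ
    have hpos : ∀ i, 0 < max (sortDesc b i) δ := fun i => lt_max_of_lt_right hδ
    have hanti : Antitone fun i => Real.log (max (sortDesc b i) δ) := fun i j hij =>
      Real.log_le_log (hpos j) (max_le_max_right _ (antitone_sortDesc b hij))
    have h₁ := sum_mul_le_sum_mul_of_maj hab hsum hanti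
    have h₂ := Finset.sum_le_sum fun i (_ : i ∈ Finset.univ) =>
      mul_log_add_sub_le (ha' i) (hpos i)
    have h₃ := Finset.sum_le_sum fun i (_ : i ∈ Finset.univ) =>
      mul_log_le_mul_log_max (δ := δ) (hb' i)
    have h₄ : ∑ i, max (sortDesc b i) δ ≤ ∑ i, sortDesc b i + n * δ := by
      have : ∑ i : Fin n, (sortDesc b i + δ) = ∑ i, sortDesc b i + n * δ := by
        simp [Finset.sum_add_distrib]
      rw [← this]
      exact Finset.sum_le_sum fun i _ => max_le (by linarith) (by linarith [hb' i])
    rw [Finset.sum_add_distrib, Finset.sum_sub_distrib] at h₂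
    simp only [mul_comm (Real.log _)] at h₁
    linarith
  refine le_of_forall_pos_le_add fun ε hε => ?_
  have hn : (0 : ℝ) < n + 1 := by positivity
  refine (key (ε / (n + 1)) (div_pos hε hn)).trans (add_le_add_right ?_ _)
  rw [mul_div_assoc', div_le_iff₀ hn]
  nlinarith

/-- Shannon entropy is Schur-concave. -/
lemma shannon_le_of_maj {n : ℕ} {a b : Fin n → ℝ} (ha : IsProbVec a) (hb : IsProbVec b)
    (hab : Maj b a) : shannon a ≤ shannon b := by
  have h := sum_mul_log_le_of_maj ha.1 hb.1 (hb.2.trans ha.2.symm) hab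
  simp only [shannon, Real.logb, ← mul_div_assoc, ← Finset.sum_div]
  exact neg_le_neg (div_le_div_of_nonneg_right h (Real.log_nonneg one_le_two))

lemma isProbVec_eigenvalues {n : ℕ} {ρ : Matrix (Fin n) (Fin n) ℂ} (hρ : ρ.PosSemidef)
    (htr : ρ.trace = 1) : IsProbVec hρ.isHermitian.eigenvalues := by
  refine ⟨hρ.eigenvalues_nonneg, ?_⟩
  have h := hρ.isHermitian.trace_eq_sum_eigenvalues
  rw [htr] at h
  refine Complex.ofReal_injective ?_
  push_cast
  exact h.symm

/-- If `X` is a set of probability vectors containing the outcome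
distribution of some von Neumann measurement on `ρ`, `m` is the majorization meet
of `X` and `c = d ∨ m`, then `λ(ρ) ≻ c` and `C_r(ρ) ≥ S(d) − S(c)`. -/
theorem stmt8 {n : ℕ} (ρ : Matrix (Fin n) (Fin n) ℂ)
    (hρ : ρ.PosSemidef) (htr : ρ.trace = 1)
    (X : Set (Fin n → ℝ)) (hXp : ∀ p ∈ X, IsProbVec p)
    (hXmeas : ∃ ψ : Fin n → (Fin n → ℂ), IsONB ψ ∧ outcome ρ ψ ∈ X)
    (m : Fin n → ℝ) (hm : IsMajMeet X m)
    (c : Fin n → ℝ) (hc : IsMajJoin (diagVec ρ) m c) :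
    Maj c hρ.isHermitian.eigenvalues ∧
    shannon (diagVec ρ) - shannon c
      ≤ shannon (diagVec ρ) - shannon hρ.isHermitian.eigenvalues := by
  obtain ⟨ψ, hψ, hψX⟩ := hXmeas
  have hprob := isProbVec_eigenvalues hρ htr
  have hd : Maj (diagVec ρ) hρ.isHermitian.eigenvalues :=
    outcome_single ρ ▸ maj_outcome_eigenvalues hρ isONB_single
  have hm' : Maj m hρ.isHermitian.eigenvalues := fun k =>
    (hm.2.1 _ hψX k).trans (maj_outcome_eigenvalues hρ hψ k)
  have hmaj := hc.2.2.2 _ hprob hd hm'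
  exact ⟨hmaj, sub_le_sub_left (shannon_le_of_maj hprob hc.1 hmaj) _⟩
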